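/- Let C : F(X,Y,Z) = 0 be a smooth plane curve of degree d ≥ 4 over a number field k with C(k) ≠ ∅. Then for every integer n ≥ gon(C,k), the curve C admits an n-level progression sequence of infinite length; this holds both with the x_i forming an infinite arithmetic progression and with the x_i forming an infinite geometric progression in k. -/

import Mathlib

open MvPolynomial

set_option synthInstance.maxHeartbeats 1000000
set_option maxHeartbeats 1000000

noncomputable section

/-- `F` defines a smooth projective plane curve of degree `d` over `k`: it is homogeneous of
degree `d` and, over the algebraic closure of `k`, `F` and its partial derivatives have no
common nontrivial zero (the Jacobian criterion for smoothness of the plane curve `F = 0`). -/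
def IsSmoothPlaneCurve {k : Type} [Field k] (d : ℕ) (F : MvPolynomial (Fin 3) k) : Prop :=
  F.IsHomogeneous d ∧
    ∀ P : Fin 3 → AlgebraicClosure k, P ≠ 0 →
      ∃ i : Fin 3, eval P (map (algebraMap k (AlgebraicClosure k)) (pderiv i F)) ≠ 0

/-- The affine coordinate ring of the plane curve `F = 0`, obtained by dehomogenizing at
`Z = 1`. Its fraction field is the function field of the curve. -/
abbrev PlaneCurveRing (k : Type) [Field k] (F : MvPolynomial (Fin 3) k) : Type :=
  MvPolynomial (Fin 2) k ⧸
    Ideal.span {(aeval ![X 0, X 1, 1] F : MvPolynomial (Fin 2) k)}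

/-- The arithmetic gonality `gon(C,k)` of the curve with function field `K` over `k`: the
least degree of a nonconstant `k`-morphism from the curve to the projective line `ℙ¹_k`,
i.e. the least index `[K : k(x)]` of a rational subfield `k(x)` with `x` nonconstant. -/
def gonality (k K : Type) [Field k] [Field K] [Algebra k K] : ℕ :=
  sInf {n : ℕ | ∃ x : K, Transcendental k x ∧
    Module.finrank (IntermediateField.adjoin k {x}) K = n}

/-- `F'` is obtained from `F` by a `k`-linear change of projective coordinates
(a `PGL₃(k)`-equivalence), so `F' = 0` is a plane model of the same curve. -/
def IsLinearChange {k : Type} [Field k] (F F' : MvPolynomial (Fin 3) k) : Prop :=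
  ∃ A : GL (Fin 3) k,
    F' = aeval (fun i => ∑ j, C ((A : Matrix (Fin 3) (Fin 3) k) i j) * X j) F

/-- `x` is an infinite geometric progression in `k`: `x i = t' * t ^ (i+1)` with `t, t' ∈ k*`. -/
def IsGeomProg {k : Type} [Field k] (x : ℕ → k) : Prop :=
  ∃ t t' : k, t ≠ 0 ∧ t' ≠ 0 ∧ ∀ i, x i = t' * t ^ (i + 1)

/-- `x` is an infinite arithmetic progression in `k`: `x i = t' + (i+1) * t` with `t, t' ∈ k*`. -/
def IsArithProg {k : Type} [Field k] (x : ℕ → k) : Prop :=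
  ∃ t t' : k, t ≠ 0 ∧ t' ≠ 0 ∧ ∀ i, x i = t' + (i + 1 : ℕ) * t

/-- The plane curve `F' = 0` carries an infinite `n`-level progression sequence with
`x`-coordinates `x i`: an infinite sequence of pairwise distinct points
`P i = (x i : 1 : z i)` on the curve, each lying in `Γ_n(C,k)`, i.e. with field of definition
of degree at most `n` over `k`. -/
def HasInfiniteLevelProg {k : Type} [Field k] (F' : MvPolynomial (Fin 3) k)
    (x : ℕ → k) (n : ℕ) : Prop :=
  ∃ P : ℕ → Fin 3 → AlgebraicClosure k, Function.Injective P ∧ ∀ i,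
    eval (P i) (map (algebraMap k (AlgebraicClosure k)) F') = 0 ∧
    P i 0 = algebraMap k (AlgebraicClosure k) (x i) ∧ P i 1 = 1 ∧
    Module.finrank k (IntermediateField.adjoin k (Set.range (P i))) ≤ n

section LinearChange

variable {k : Type} [Field k]

/-- The substitution of the linear forms given by the rows of `A` into `F`. -/
def linSubst (A : Matrix (Fin 3) (Fin 3) k) (F : MvPolynomial (Fin 3) k) :
    MvPolynomial (Fin 3) k :=
  aeval (fun i => ∑ j, C (A i j) * X j) F

lemma aeval_linSubst {S : Type} [CommRing S] [Algebra k S] (A : Matrix (Fin 3) (Fin 3) k)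
    (F : MvPolynomial (Fin 3) k) (p : Fin 3 → S) :
    aeval p (linSubst A F) = aeval (fun i => ∑ j, algebraMap k S (A i j) * p j) F := by
  rw [linSubst, ← AlgHom.comp_apply, comp_aeval]
  congr 2
  ext i
  simp

lemma pderiv_linSubst (A : Matrix (Fin 3) (Fin 3) k) (F : MvPolynomial (Fin 3) k) (j : Fin 3) :
    pderiv j (linSubst A F) = ∑ i, C (A i j) * linSubst A (pderiv i F) := by
  unfold linSubst
  induction F using MvPolynomial.induction_on with
  | C a => simp
  | add p q hp hq => simp only [map_add, hp, hq, mul_add, Finset.sum_add_distrib]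
  | mul_X p i hp =>
    simp only [map_mul, aeval_X, Derivation.leibniz, hp, map_add, smul_eq_mul]
    have h1 : pderiv j (∑ l, C (A i l) * X l : MvPolynomial (Fin 3) k) = C (A i j) := by
      simp [pderiv_X, Pi.single_apply]
    rw [h1]
    simp only [mul_add, Finset.sum_add_distrib, pderiv_X, Pi.single_apply]
    congr 1
    · simp [mul_comm]
    · rw [Finset.mul_sum]
      exact Finset.sum_congr rfl fun l _ => by ring

lemma IsSmoothPlaneCurve.exists_aeval_pderiv_ne_zero {d : ℕ} {F : MvPolynomial (Fin 3) k}
    (hF : IsSmoothPlaneCurve d F) {P : Fin 3 → AlgebraicClosure k} (hP : P ≠ 0) :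
    ∃ i, aeval P (pderiv i F) ≠ 0 := by
  obtain ⟨i, hi⟩ := hF.2 P hP
  exact ⟨i, by rwa [eval_map, ← aeval_def] at hi⟩

lemma IsSmoothPlaneCurve.exists_eval_pderiv_ne_zero {d : ℕ} {F : MvPolynomial (Fin 3) k}
    (hF : IsSmoothPlaneCurve d F) {P : Fin 3 → k} (hP : P ≠ 0) :
    ∃ i, eval P (pderiv i F) ≠ 0 := by
  have hP' : (fun i => algebraMap k (AlgebraicClosure k) (P i)) ≠ 0 := by
    refine fun h => hP (funext fun i => ?_)
    simpa using congrFun h i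
  obtain ⟨i, hi⟩ := hF.exists_aeval_pderiv_ne_zero hP'
  refine ⟨i, fun h => hi ?_⟩
  have := aeval_algebraMap_apply (AlgebraicClosure k) P (pderiv i F)
  rw [Function.comp_def] at this
  rw [this, aeval_eq_eval, h, map_zero]

lemma IsSmoothPlaneCurve.linSubst {d : ℕ} {F : MvPolynomial (Fin 3) k}
    (hF : IsSmoothPlaneCurve d F) {A : Matrix (Fin 3) (Fin 3) k} (hA : IsUnit A.det) :
    IsSmoothPlaneCurve d (linSubst A F) := by
  refine ⟨?_, fun P hP => ?_⟩
  · have := hF.1.aeval (n := 1) (fun i => ∑ j, C (A i j) * X j : Fin 3 → MvPolynomial (Fin 3) k)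
      fun i => IsHomogeneous.sum _ _ _ fun j _ => by
        simpa using (isHomogeneous_C (Fin 3) (A i j)).mul (isHomogeneous_X k j)
    simpa using! this
  set φ := algebraMap k (AlgebraicClosure k)
  have hA' : IsUnit (A.map φ).det := by
    have := hA.map φ
    rwa [φ.map_det] at this
  set Q : Fin 3 → AlgebraicClosure k := (A.map φ).mulVec P with hQ
  have hQ0 : Q ≠ 0 := fun h =>
    hP (Matrix.eq_zero_of_mulVec_eq_zero hA'.ne_zero h)
  obtain ⟨i, hi⟩ := hF.exists_aeval_pderiv_ne_zero hQ0
  by_contra! h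
  have h0 : Matrix.vecMul (fun i => aeval Q (pderiv i F)) (A.map φ) = 0 := by
    ext j
    have := h j
    rw [eval_map, ← aeval_def, pderiv_linSubst, map_sum] at this
    simp only [Pi.zero_apply, ← this, Matrix.vecMul, dotProduct, map_mul, aeval_linSubst, aeval_C]
    exact Finset.sum_congr rfl fun l _ => mul_comm _ _
  exact hi (congrFun (Matrix.eq_zero_of_vecMul_eq_zero hA'.ne_zero h0) i)

end LinearChange

section Line

variable {k : Type} [Field k] {A : Type} [CommRing A] [Algebra k A]

/-- The restriction of the form `F` to the line `T ↦ v + T • w`. -/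
def lineSubst (v : Fin 3 → A) (w : Fin 3 → k) (F : MvPolynomial (Fin 3) k) : Polynomial A :=
  aeval (fun i => Polynomial.C (v i) + Polynomial.C (algebraMap k A (w i)) * Polynomial.X) F

lemma aeval_lineSubst {B : Type} [CommRing B] [Algebra A B] [Algebra k B] [IsScalarTower k A B]
    (v : Fin 3 → A) (w : Fin 3 → k) (F : MvPolynomial (Fin 3) k) (y : B) :
    Polynomial.aeval y (lineSubst v w F) =
      aeval (fun i => algebraMap A B (v i) + algebraMap k B (w i) * y) F := by
  have : Polynomial.aeval y (lineSubst v w F) =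
    ((Polynomial.aeval y : Polynomial A →ₐ[A] B).restrictScalars k) (lineSubst v w F) := rfl
  rw [this, lineSubst, ← AlgHom.comp_apply, comp_aeval]
  congr 2
  ext i
  simp [← IsScalarTower.algebraMap_apply]

lemma derivative_lineSubst (v : Fin 3 → A) (w : Fin 3 → k) (F : MvPolynomial (Fin 3) k) :
    Polynomial.derivative (lineSubst v w F) =
      ∑ i, Polynomial.C (algebraMap k A (w i)) * lineSubst v w (pderiv i F) := by
  set f : Fin 3 → Polynomial A :=
    fun i => Polynomial.C (v i) + Polynomial.C (algebraMap k A (w i)) * Polynomial.X with hf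
  have h1 : ∀ i, Polynomial.derivative (f i) = Polynomial.C (algebraMap k A (w i)) :=
    fun i => by simp [hf]
  change Polynomial.derivative (aeval f F) =
    ∑ i, Polynomial.C (algebraMap k A (w i)) * aeval f (pderiv i F)
  clear_value f
  induction F using MvPolynomial.induction_on with
  | C a => simp [IsScalarTower.algebraMap_apply k A (Polynomial A)]
  | add p q hp hq => simp only [map_add, hp, hq, mul_add, Finset.sum_add_distrib]
  | mul_X p i hp =>
    simp only [map_mul, aeval_X]
    rw [Polynomial.derivative_mul, hp, h1]
    simp only [Derivation.leibniz, map_add, smul_eq_mul, map_mul, aeval_X, mul_add,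
      Finset.sum_add_distrib, pderiv_X, Pi.single_apply]
    rw [add_comm]
    congr 1
    · simp [mul_comm]
    · rw [Finset.sum_mul]
      exact Finset.sum_congr rfl fun l _ => by ring

lemma natDegree_lineSubst_le_and_coeff {m : ℕ} {F : MvPolynomial (Fin 3) k}
    (hF : F.IsHomogeneous m) (v : Fin 3 → A) (w : Fin 3 → k) :
    (lineSubst v w F).natDegree ≤ m ∧
      (lineSubst v w F).coeff m = algebraMap k A (eval w F) := by
  set f : Fin 3 → Polynomial A :=
    fun i => Polynomial.C (v i) + Polynomial.C (algebraMap k A (w i)) * Polynomial.X with hf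
  have hdeg : ∀ i, (f i).natDegree ≤ 1 := fun i => by
    simp only [hf]; compute_degree
  have hco : ∀ i, (f i).coeff 1 = algebraMap k A (w i) := fun i => by
    simp [hf, Polynomial.coeff_C]
  have hmon : ∀ n : Fin 3 →₀ ℕ, n.degree = m → (∏ i, f i ^ n i).natDegree ≤ m ∧
      (∏ i, f i ^ n i).coeff m = algebraMap k A (∏ i, w i ^ n i) := by
    intro n hn
    have e : n 0 + n 1 + n 2 = m := by
      rw [← hn, Finsupp.degree_eq_sum, Fin.sum_univ_three]
    have hd : ∀ i, (f i ^ n i).natDegree ≤ n i := fun i => by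
      simpa using Polynomial.natDegree_pow_le_of_le (n i) (hdeg i)
    have hc : ∀ i, (f i ^ n i).coeff (n i) = algebraMap k A (w i) ^ n i := fun i => by
      have := Polynomial.coeff_pow_of_natDegree_le (m := n i) (hdeg i)
      simpa [hco] using this
    rw [Fin.prod_univ_three, ← e]
    refine ⟨Polynomial.natDegree_mul_le_of_le (Polynomial.natDegree_mul_le_of_le (hd 0) (hd 1))
      (hd 2), ?_⟩
    rw [Polynomial.coeff_mul_add_eq_of_natDegree_le
      (Polynomial.natDegree_mul_le_of_le (hd 0) (hd 1)) (hd 2),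
      Polynomial.coeff_mul_add_eq_of_natDegree_le (hd 0) (hd 1), hc, hc, hc, Fin.prod_univ_three]
    simp
  have hsum : lineSubst v w F = ∑ n ∈ F.support,
      Polynomial.C (algebraMap k A (F.coeff n)) * ∏ i, f i ^ n i := by
    rw [lineSubst, aeval_def, eval₂_eq']
    rfl
  have hsupp : ∀ n ∈ F.support, n.degree = m := fun n hn => by
    have := hF (mem_support_iff.mp hn)
    rwa [Finsupp.degree_eq_weight_one]
  rw [hsum]
  constructor
  · refine Polynomial.natDegree_sum_le_of_forall_le _ _ fun n hn => ?_
    exact (Polynomial.natDegree_C_mul_le _ _).trans (hmon n (hsupp n hn)).1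
  · rw [Polynomial.finsetSum_coeff, eval_eq', map_sum]
    refine Finset.sum_congr rfl fun n hn => ?_
    rw [Polynomial.coeff_C_mul, (hmon n (hsupp n hn)).2, map_mul]

end Line

section Integral

/-- If the coefficients of `P` are integral over `A` and `P(t) = 0`, then the values at `t` of the
successive quotients of `P` by powers of the variable are integral over `A`. -/
lemma isIntegral_eval_iterate_divX {A K : Type} [CommRing A] [Field K] [Algebra A K]
    (P : Polynomial K) (hP : ∀ i, IsIntegral A (P.coeff i)) (t : K) (ht : P.eval t = 0) (j : ℕ) :
    IsIntegral A ((Polynomial.divX^[j] P).eval t) := by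
  have hcoeff : ∀ j i, (Polynomial.divX^[j] P).coeff i = P.coeff (i + j) := by
    intro j
    induction j with
    | zero => simp
    | succ j ih =>
      intro i
      rw [Function.iterate_succ_apply', Polynomial.coeff_divX, ih]
      congr 1
      ring
  have hrec : ∀ j, (Polynomial.divX^[j] P).eval t =
      (Polynomial.divX^[j + 1] P).eval t * t + P.coeff j := by
    intro j
    conv_lhs => rw [← Polynomial.divX_mul_X_add (Polynomial.divX^[j] P)]
    rw [Function.iterate_succ_apply']
    simp [hcoeff]
  have htrunc : ∀ j, ∑ i ∈ Finset.range j, P.coeff i * t ^ i +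
      (Polynomial.divX^[j] P).eval t * t ^ j = 0 := by
    intro j
    induction j with
    | zero => simpa using ht
    | succ j ih =>
      rw [hrec j] at ih
      rw [Finset.sum_range_succ, ← ih]
      ring
  have hbig : ∀ j, P.natDegree < j → Polynomial.divX^[j] P = 0 := by
    intro j hj
    ext i
    rw [hcoeff, Polynomial.coeff_zero, Polynomial.coeff_eq_zero_of_natDegree_lt (by omega)]
  by_cases hj : P.natDegree < j
  · rw [hbig j hj]
    simpa using isIntegral_zero
  push Not at hj
  refine Nat.decreasingInduction (motive := fun j _ =>
    IsIntegral A ((Polynomial.divX^[j] P).eval t)) (n := P.natDegree + 1) ?_ ?_ (by omega : j ≤ _)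
  · intro j _ ih
    rw [hrec j]
    refine IsIntegral.add ?_ (hP j)
    set n := (Polynomial.divX^[j + 1] P).eval t with hn
    by_cases hn0 : n = 0
    · simpa [hn0] using isIntegral_zero
    let B := integralClosure A K
    let Q : Polynomial B := ∑ i ∈ Finset.range (j + 1), Polynomial.monomial i (⟨P.coeff i, hP i⟩ : B)
      + Polynomial.monomial (j + 1) (⟨n, ih⟩ : B)
    have hlt : (∑ i ∈ Finset.range (j + 1),
        Polynomial.monomial i (⟨P.coeff i, hP i⟩ : B)).degree < ((j + 1 : ℕ) : WithBot ℕ) := by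
      refine (Polynomial.degree_sum_le _ _).trans_lt ?_
      rw [Finset.sup_lt_iff (WithBot.bot_lt_coe _)]
      intro i hi
      refine (Polynomial.degree_monomial_le _ _).trans_lt ?_
      exact_mod_cast Finset.mem_range.mp hi
    have hdeg : (Polynomial.monomial (j + 1) (⟨n, ih⟩ : B)).degree = ((j + 1 : ℕ) : WithBot ℕ) :=
      Polynomial.degree_monomial _ (fun h => hn0 (congrArg Subtype.val h))
    have hlead : Q.leadingCoeff = ⟨n, ih⟩ := by
      simp only [Q]
      rw [Polynomial.leadingCoeff_add_of_degree_lt (by rw [hdeg]; exact hlt),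
        Polynomial.leadingCoeff_monomial]
    have hQ : Polynomial.aeval t Q = 0 := by
      simp only [Q, map_add, map_sum, Polynomial.aeval_monomial]
      exact htrunc (j + 1)
    have := isIntegral_leadingCoeff_smul Q t hQ
    rw [hlead] at this
    exact isIntegral_trans (R := A) (A := B) _ this
  · rw [hbig _ (Nat.lt_succ_self _)]
    simpa using isIntegral_zero

end Integral

section Conductor

open scoped IntermediateField.algebraAdjoinAdjoin
open IntermediateField

/-- The monic polynomial in `Y` proportional to `F(a, Y, 1)`. -/
def monicLine {k A : Type} [Field k] [CommRing A] [Algebra k A] (a : A)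
    (F : MvPolynomial (Fin 3) k) : Polynomial A :=
  Polynomial.C (algebraMap k A (eval ![0, 1, 0] F)⁻¹) * lineSubst ![a, 0, 1] ![0, 1, 0] F

section MonicLine

variable {k A : Type} [Field k] [CommRing A] [Algebra k A] {d : ℕ}
  {F : MvPolynomial (Fin 3) k}

lemma monicLine_natDegree_le (hF : F.IsHomogeneous d) (a : A) :
    (monicLine a F).natDegree ≤ d :=
  (Polynomial.natDegree_C_mul_le _ _).trans (natDegree_lineSubst_le_and_coeff hF _ _).1

lemma monicLine_coeff (hF : F.IsHomogeneous d) (hc : eval ![0, 1, 0] F ≠ 0) (a : A) :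
    (monicLine a F).coeff d = 1 := by
  rw [monicLine, Polynomial.coeff_C_mul, (natDegree_lineSubst_le_and_coeff hF _ _).2, ← map_mul,
    inv_mul_cancel₀ hc, map_one]

lemma monicLine_monic (hF : F.IsHomogeneous d) (hc : eval ![0, 1, 0] F ≠ 0) (a : A) :
    (monicLine a F).Monic :=
  Polynomial.monic_of_natDegree_le_of_coeff_eq_one d (monicLine_natDegree_le hF a)
    (monicLine_coeff hF hc a)

lemma monicLine_natDegree [Nontrivial A] (hF : F.IsHomogeneous d) (hc : eval ![0, 1, 0] F ≠ 0)
    (a : A) : (monicLine a F).natDegree = d :=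
  Polynomial.natDegree_eq_of_le_of_coeff_ne_zero (monicLine_natDegree_le hF a)
    (by rw [monicLine_coeff hF hc]; exact one_ne_zero)

lemma aeval_lineSubst_vertical {B : Type} [CommRing B] [Algebra A B] [Algebra k B]
    [IsScalarTower k A B] (a : A) (y : B) (G : MvPolynomial (Fin 3) k) :
    Polynomial.aeval y (lineSubst ![a, 0, 1] ![0, 1, 0] G) =
      aeval ![algebraMap A B a, y, 1] G := by
  rw [aeval_lineSubst]
  congr 2
  ext i
  fin_cases i <;> simp

lemma aeval_monicLine {B : Type} [CommRing B] [Algebra A B] [Algebra k B]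
    [IsScalarTower k A B] (a : A) (y : B) (h0 : aeval ![algebraMap A B a, y, 1] F = 0) :
    Polynomial.aeval y (monicLine a F) = 0 := by
  rw [monicLine, map_mul, aeval_lineSubst_vertical, h0, mul_zero]

lemma aeval_derivative_monicLine {B : Type} [CommRing B] [Algebra A B] [Algebra k B]
    [IsScalarTower k A B] (a : A) (y : B) :
    Polynomial.aeval y (Polynomial.derivative (monicLine a F)) =
      algebraMap k B (eval ![0, 1, 0] F)⁻¹ * aeval ![algebraMap A B a, y, 1] (pderiv 1 F) := by
  rw [monicLine, Polynomial.derivative_C_mul, derivative_lineSubst, Fin.sum_univ_three]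
  simp [aeval_lineSubst_vertical, ← IsScalarTower.algebraMap_apply]

end MonicLine

lemma isIntegrallyClosed_adjoin {k K : Type} [Field k] [Field K] [Algebra k K] {x : K}
    (hx : Transcendental k x) : IsIntegrallyClosed (Algebra.adjoin k {x}) :=
  IsIntegrallyClosed.of_equiv (Polynomial.algEquivOfTranscendental k x hx).toRingEquiv

/-- For a form `F` of degree `d` vanishing at `p = (x : y : 1)` and not vanishing at `(0 : 1 : 0)`,
the coordinate `y` is integral over `k[x]`. -/
lemma isIntegral_of_eval_ne_zero {k K : Type} [Field k] [Field K] [Algebra k K] {d : ℕ}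
    {F : MvPolynomial (Fin 3) k} (hF : F.IsHomogeneous d)
    {x y : K} (h0 : aeval ![x, y, 1] F = 0) (hc : eval ![0, 1, 0] F ≠ 0) :
    IsIntegral (Algebra.adjoin k {x}) y := by
  let a : Algebra.adjoin k {x} := ⟨x, Algebra.self_mem_adjoin_singleton k x⟩
  refine ⟨monicLine a F, monicLine_monic hF hc a, ?_⟩
  rw [← Polynomial.aeval_def]
  exact aeval_monicLine a y h0

lemma adjoin_simple_eq_top {k K : Type} [Field k] [Field K] [Algebra k K] {x y : K}
    (hxy : IntermediateField.adjoin k {x, y} = ⊤) : k⟮x⟯⟮y⟯ = ⊤ := by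
  rw [← restrictScalars_eq_top_iff (K := k), adjoin_simple_adjoin_simple, hxy]

lemma algebraAdjoin_simple_eq_top {k K : Type} [Field k] [Field K] [Algebra k K] {x y : K}
    (hxy : IntermediateField.adjoin k {x, y} = ⊤) (hy : IsIntegral k⟮x⟯ y) :
    Algebra.adjoin k⟮x⟯ {y} = ⊤ := by
  rw [← adjoin_simple_toSubalgebra_of_isAlgebraic hy.isAlgebraic, adjoin_simple_eq_top hxy,
    top_toSubalgebra]

/-- The partial derivative `∂F/∂Y` multiplies the integral closure of `k[x]` into the coordinate
ring of the affine chart. -/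
lemma aeval_pderiv_mul_mem {k K : Type} [Field k] [CharZero k] [Field K] [Algebra k K] {d : ℕ}
    {F : MvPolynomial (Fin 3) k} (hF : F.IsHomogeneous d)
    {x y : K} (h0 : aeval ![x, y, 1] F = 0) (hc : eval ![0, 1, 0] F ≠ 0)
    (hx : Transcendental k x) (hxy : IntermediateField.adjoin k {x, y} = ⊤)
    {b : K} (hb : IsIntegral (Algebra.adjoin k {x}) b) :
    aeval ![x, y, 1] (pderiv 1 F) * b ∈
      (aeval ![x, y, 1] : MvPolynomial (Fin 3) k →ₐ[k] K).range := by
  set A := Algebra.adjoin k {x} with hA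
  set a : A := ⟨x, Algebra.self_mem_adjoin_singleton k x⟩ with ha
  have : IsIntegrallyClosed A := isIntegrallyClosed_adjoin hx
  have hy : IsIntegral A y := isIntegral_of_eval_ne_zero hF h0 hc
  have hyL : IsIntegral k⟮x⟯ y := hy.tower_top
  have htop := algebraAdjoin_simple_eq_top hxy hyL
  have : FiniteDimensional k⟮x⟯ K := by
    have := IntermediateField.adjoin.finiteDimensional hyL
    rw [adjoin_simple_eq_top hxy] at this
    exact topEquiv.toLinearEquiv.finiteDimensional
  have : CharZero k⟮x⟯ := charZero_of_injective_algebraMap (algebraMap k _).injective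
  have hdual := traceForm_dualSubmodule_adjoin A k⟮x⟯ htop hy
  have hAy : ∀ z ∈ Algebra.adjoin A {y},
      z ∈ (aeval ![x, y, 1] : MvPolynomial (Fin 3) k →ₐ[k] K).range := by
    intro z hz
    induction hz using Algebra.adjoin_induction with
    | mem z hz => 
      rw [Set.mem_singleton_iff.mp hz]
      exact ⟨X 1, by simp⟩
    | algebraMap r =>
      refine Algebra.adjoin_le (S := (aeval ![x, y, 1] : MvPolynomial (Fin 3) k →ₐ[k] K).range)
        ?_ r.2
      rintro _ rfl
      exact ⟨X 0, by simp⟩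
    | add _ _ _ _ h1 h2 => exact add_mem h1 h2
    | mul _ _ _ _ h1 h2 => exact mul_mem h1 h2
  have hbdual : b ∈ (Algebra.traceForm k⟮x⟯ K).dualSubmodule
      (Subalgebra.toSubmodule (Algebra.adjoin A {y})) := by
    rw [LinearMap.BilinForm.mem_dualSubmodule]
    intro z hz
    have hz' : IsIntegral A z := by
      have : Algebra.adjoin A {y} ≤ integralClosure A K :=
        Algebra.adjoin_le (by rintro _ rfl; exact hy)
      exact this hz
    rw [Submodule.mem_one, Algebra.traceForm_apply]
    exact IsIntegrallyClosed.isIntegral_iff.mp (Algebra.isIntegral_trace (hb.mul hz'))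
  rw [hdual, ← SetLike.mem_coe, Submodule.coe_pointwise_smul, Set.mem_smul_set] at hbdual
  obtain ⟨z, hz, rfl⟩ := hbdual
  obtain ⟨Q, hQ⟩ := minpoly.isIntegrallyClosed_dvd hy
    (aeval_monicLine (F := F) a y h0)
  have hder := aeval_derivative_monicLine (F := F) a y
  have hmap : Polynomial.aeval y (minpoly k⟮x⟯ y).derivative =
      Polynomial.aeval y (minpoly A y).derivative := by
    rw [minpoly.isIntegrallyClosed_eq_field_fractions' k⟮x⟯ hy, Polynomial.derivative_map,
      Polynomial.aeval_map_algebraMap]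
  rw [hQ, Polynomial.derivative_mul, map_add, map_mul, map_mul, minpoly.aeval, zero_mul,
    add_zero, ← hmap] at hder
  set δ := Polynomial.aeval y (minpoly k⟮x⟯ y).derivative with hδ
  have hδ0 : δ ≠ 0 :=
    (Algebra.IsSeparable.isSeparable k⟮x⟯ y).aeval_derivative_ne_zero (minpoly.aeval _ _)
  have hc' : algebraMap k K (eval ![0, 1, 0] F)⁻¹ ≠ 0 := by simpa using hc
  have key : aeval ![x, y, 1] (pderiv 1 F) * (δ⁻¹ • z) =
      algebraMap k K (eval ![0, 1, 0] F) * (Polynomial.aeval y Q * z) := by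
    have h2 : aeval ![x, y, 1] (pderiv 1 F) =
        algebraMap k K (eval ![0, 1, 0] F) * (δ * Polynomial.aeval y Q) := by
      rw [hder, ← mul_assoc, ← map_mul, mul_inv_cancel₀ hc, map_one, one_mul]
      rfl
    rw [h2, smul_eq_mul]
    field_simp
  rw [key]
  refine mul_mem (Subalgebra.algebraMap_mem _ _) (mul_mem (hAy _ ?_) (hAy _ hz))
  exact Polynomial.aeval_mem_adjoin_singleton A y

end Conductor

section Normality

open IntermediateField

variable {k K : Type} [Field k] [Field K] [Algebra k K]

lemma isIntegral_adjoin_trans {x x' b : K} (hx : IsIntegral (Algebra.adjoin k {x'}) x)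
    (hb : IsIntegral (Algebra.adjoin k {x}) b) : IsIntegral (Algebra.adjoin k {x'}) b := by
  set B := integralClosure (Algebra.adjoin k {x'}) K
  have hle : Algebra.adjoin k {x} ≤ B.restrictScalars k :=
    Algebra.adjoin_le (by rintro _ rfl; exact hx)
  have : IsIntegral B (RingHom.id K b) :=
    hb.map_of_comp_eq (Subalgebra.inclusion hle).toRingHom (RingHom.id K) (by ext; rfl)
  exact isIntegral_trans (R := Algebra.adjoin k {x'}) (A := B) _ this

lemma transcendental_of_isIntegral_adjoin {x x' : K} (hx : Transcendental k x)
    (h : IsIntegral (Algebra.adjoin k {x'}) x) : Transcendental k x' := by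
  intro halg
  have : Algebra.IsIntegral k (Algebra.adjoin k {x'}) :=
    Algebra.IsIntegral.adjoin (by rintro _ rfl; exact halg.isIntegral)
  exact hx (isIntegral_trans (R := k) (A := Algebra.adjoin k {x'}) _ h).isAlgebraic

/-- The shear `X ↦ X - c Y`. -/
def shear (c : k) : Matrix (Fin 3) (Fin 3) k := !![1, -c, 0; 0, 1, 0; 0, 0, 1]

lemma det_shear (c : k) : (shear c).det = 1 := by
  simp [shear, Matrix.det_fin_three]

lemma aeval_linSubst_shear {S : Type} [CommRing S] [Algebra k S] (c : k)
    (F : MvPolynomial (Fin 3) k) (x y z : S) :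
    aeval ![x, y, z] (linSubst (shear c) F) = aeval ![x - algebraMap k S c * y, y, z] F := by
  rw [aeval_linSubst]
  congr 2
  ext i
  fin_cases i <;> simp [shear, Fin.sum_univ_three]
  ring

lemma pderiv_linSubst_shear (c : k) (F : MvPolynomial (Fin 3) k) :
    pderiv 1 (linSubst (shear c) F) =
      linSubst (shear c) (pderiv 1 F) - C c * linSubst (shear c) (pderiv 0 F) := by
  rw [pderiv_linSubst, Fin.sum_univ_three]
  simp [shear]
  ring

lemma eval_eq_aeval (p : Fin 3 → k) (F : MvPolynomial (Fin 3) k) : eval p F = aeval p F := by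
  rw [aeval_eq_eval]

lemma eval_linSubst_shear (c : k) (F : MvPolynomial (Fin 3) k) (x y z : k) :
    eval ![x, y, z] (linSubst (shear c) F) = eval ![x - c * y, y, z] F := by
  simp only [eval_eq_aeval, aeval_linSubst_shear, Algebra.algebraMap_self, RingHom.id_apply]

lemma adjoin_shear_eq_top {x y : K} (hxy : IntermediateField.adjoin k {x, y} = ⊤) (c : k) :
    IntermediateField.adjoin k {x + algebraMap k K c * y, y} = ⊤ := by
  rw [← top_le_iff, ← hxy, adjoin_le_iff]
  have hy : y ∈ IntermediateField.adjoin k {x + algebraMap k K c * y, y} :=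
    subset_adjoin _ _ (by simp)
  have hx' : x + algebraMap k K c * y ∈ IntermediateField.adjoin k {x + algebraMap k K c * y, y} :=
    subset_adjoin _ _ (by simp)
  rintro z (rfl | rfl)
  · simpa using sub_mem hx' (mul_mem (IntermediateField.algebraMap_mem _ c) hy)
  · exact hy

lemma exists_eval_shear_ne_zero [Infinite k] {F : MvPolynomial (Fin 3) k}
    (hc : eval ![0, 1, 0] F ≠ 0) : ∃ c : k, c ≠ 0 ∧ eval ![-c, 1, 0] F ≠ 0 := by
  set g : Polynomial k := lineSubst ![0, 1, 0] ![1, 0, 0] F with hg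
  have hev : ∀ c, g.eval c = eval ![c, 1, 0] F := by
    intro c
    rw [← Polynomial.coe_aeval_eq_eval, hg, aeval_lineSubst, eval_eq_aeval]
    congr 2
    ext i
    fin_cases i <;> simp
  have hg0 : g ≠ 0 := by
    intro h
    apply hc
    rw [← hev, h, Polynomial.eval_zero]
  obtain ⟨c, hc⟩ : ∃ c, (g * Polynomial.X).eval c ≠ 0 := by
    by_contra! h
    exact mul_ne_zero hg0 Polynomial.X_ne_zero (Polynomial.funext (by simpa using h))
  rw [Polynomial.eval_mul, Polynomial.eval_X, hev] at hc
  exact ⟨-c, neg_ne_zero.mpr (right_ne_zero_of_mul hc), by simpa using left_ne_zero_of_mul hc⟩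

/-- A smooth affine plane curve is normal: an element of the function field which is integral over
`k[x]` is a polynomial in the affine coordinates. -/
lemma mem_range_of_isIntegral [CharZero k] {d : ℕ}
    {F : MvPolynomial (Fin 3) k} (hF : IsSmoothPlaneCurve d F)
    {x y : K} (h0 : aeval ![x, y, 1] F = 0) (hc : eval ![0, 1, 0] F ≠ 0)
    (hx : Transcendental k x) (hxy : IntermediateField.adjoin k {x, y} = ⊤)
    {b : K} (hb : IsIntegral (Algebra.adjoin k {x}) b) :
    b ∈ (aeval ![x, y, 1] : MvPolynomial (Fin 3) k →ₐ[k] K).range := by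
  obtain ⟨c, hc0, hcF⟩ := exists_eval_shear_ne_zero hc
  set R := (aeval ![x, y, 1] : MvPolynomial (Fin 3) k →ₐ[k] K).range with hR
  have hY : aeval ![x, y, 1] (pderiv 1 F) * b ∈ R := aeval_pderiv_mul_mem hF.1 h0 hc hx hxy hb
  have hX : aeval ![x, y, 1] (pderiv 0 F) * b ∈ R := by
    set x' := x + algebraMap k K c * y with hx'
    set F' := linSubst (shear c) F with hF'
    have hev : ∀ G, aeval ![x', y, 1] (linSubst (shear c) G) = aeval ![x, y, 1] G := fun G => by
      rw [aeval_linSubst_shear, hx', add_sub_cancel_right]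
    have hsm : IsSmoothPlaneCurve d F' := hF.linSubst (by rw [det_shear]; exact isUnit_one)
    have h0' : aeval ![x', y, 1] F' = 0 := by rw [hev, h0]
    have hc' : eval ![0, 1, 0] F' ≠ 0 := by
      rw [hF', eval_linSubst_shear]
      simpa using hcF
    have hyint := isIntegral_of_eval_ne_zero hsm.1 h0' hc'
    have hxint : IsIntegral (Algebra.adjoin k {x'}) x := by
      have h1 : IsIntegral (Algebra.adjoin k {x'}) x' :=
        isIntegral_algebraMap (x := (⟨x', Algebra.self_mem_adjoin_singleton k x'⟩ :
          Algebra.adjoin k {x'}))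
      have h2 : IsIntegral (Algebra.adjoin k {x'}) (algebraMap k K c) := by
        rw [IsScalarTower.algebraMap_apply k (Algebra.adjoin k {x'}) K]
        exact isIntegral_algebraMap
      simpa [hx'] using h1.sub (h2.mul hyint)
    have := aeval_pderiv_mul_mem hsm.1 h0' hc' (transcendental_of_isIntegral_adjoin hx hxint)
      (adjoin_shear_eq_top hxy c) (isIntegral_adjoin_trans hxint hb)
    have hle : (aeval ![x', y, 1] : MvPolynomial (Fin 3) k →ₐ[k] K).range ≤ R := by
      rw [← Algebra.adjoin_range_eq_range_aeval]
      refine Algebra.adjoin_le ?_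
      rintro _ ⟨i, rfl⟩
      fin_cases i
      · exact ⟨X 0 + C c * X 1, by simp [hx']⟩
      · exact ⟨X 1, by simp⟩
      · exact ⟨1, by simp⟩
    have hmem := hle this
    rw [hF', pderiv_linSubst_shear, map_sub, map_mul, hev, hev, aeval_C] at hmem
    have h3 := mul_mem (R.algebraMap_mem c⁻¹) (sub_mem hY hmem)
    have hcK : algebraMap k K c ≠ 0 := by simpa using hc0
    convert h3 using 1
    rw [map_inv₀]
    field_simp
    ring
  let I : Ideal (MvPolynomial (Fin 3) k) :=
    { carrier := {G | aeval ![x, y, 1] G * b ∈ R}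
      zero_mem' := by simp
      add_mem' := fun {G H} hG hH => by
        simp only [Set.mem_ofPred_eq, map_add, add_mul] at *
        exact add_mem hG hH
      smul_mem' := fun G H hH => by
        simp only [Set.mem_ofPred_eq, smul_eq_mul, map_mul, mul_assoc] at *
        exact mul_mem ⟨G, rfl⟩ hH }
  have hI : I = ⊤ := by
    suffices h : zeroLocus (AlgebraicClosure k) I = ∅ by
      rw [← Ideal.radical_eq_top, ← vanishingIdeal_zeroLocus_eq_radical (K := AlgebraicClosure k) I,
        h, vanishingIdeal_empty]
    refine Set.eq_empty_of_forall_notMem fun P hP => ?_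
    rw [mem_zeroLocus_iff] at hP
    have hP2 : P 2 = 1 := by
      have := hP (X 2 - 1) (by simp [I])
      simpa [sub_eq_zero] using this
    have hPF : aeval P F = 0 := hP F (by simp [I, h0])
    have hP0 : aeval P (pderiv 0 F) = 0 := hP _ hX
    have hP1 : aeval P (pderiv 1 F) = 0 := hP _ hY
    have heul := congrArg (aeval P) hF.1.sum_X_mul_pderiv
    simp only [Fin.sum_univ_three, map_add, map_mul, aeval_X, hP0, hP1, hP2, map_nsmul, hPF] at heul
    obtain ⟨i, hi⟩ := hF.exists_aeval_pderiv_ne_zero (P := P)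
      (fun h => by simp [h] at hP2)
    fin_cases i
    · exact hi hP0
    · exact hi hP1
    · exact hi (by simpa using heul)
  have h1 : (1 : MvPolynomial (Fin 3) k) ∈ I := hI ▸ Submodule.mem_top
  simpa [I] using h1

end Normality

section Noether

open IntermediateField algebraAdjoinAdjoin

variable {k K : Type} [Field k] [Field K] [Algebra k K]

lemma aeval_mul_of_isHomogeneous {d : ℕ} {F : MvPolynomial (Fin 3) k} (hF : F.IsHomogeneous d)
    (c : K) (p : Fin 3 → K) : aeval (fun i => c * p i) F = c ^ d * aeval p F := by
  rw [aeval_def, aeval_def, eval₂_eq', eval₂_eq', Finset.mul_sum]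
  refine Finset.sum_congr rfl fun m hm => ?_
  have hdeg : ∑ i, m i = d := by
    rw [← hF (mem_support_iff.mp hm), Finsupp.weight_apply, Finsupp.sum_fintype _ _ (by simp)]
    simp
  simp only [mul_pow, Finset.prod_mul_distrib, Finset.prod_pow_eq_pow_sum, hdeg]
  ring

/-- The exchange `X ↔ Z` of projective coordinates. -/
def swapXZ (k : Type) [Field k] : Matrix (Fin 3) (Fin 3) k := !![0, 0, 1; 0, 1, 0; 1, 0, 0]

lemma isUnit_det_swapXZ : IsUnit (swapXZ k).det := by
  simp [swapXZ, Matrix.det_fin_three]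

lemma aeval_linSubst_swapXZ (F : MvPolynomial (Fin 3) k) (x y z : K) :
    aeval ![x, y, z] (linSubst (swapXZ k) F) = aeval ![z, y, x] F := by
  rw [aeval_linSubst]
  congr 2
  ext i
  fin_cases i <;> simp [swapXZ, Fin.sum_univ_three]

lemma exists_aeval_eq_of_mem_adjoin {x z : K} (hz : z ∈ Algebra.adjoin k {x}) :
    ∃ p : Polynomial k, Polynomial.aeval x p = z := by
  rwa [Algebra.adjoin_singleton_eq_range_aeval] at hz

/-- An element of the function field integral over `k[x]` is a `k[x]`-combination of the powers
`1, y, …, y ^ (d - 1)`. -/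
lemma exists_eq_sum_of_isIntegral [CharZero k] {d : ℕ} (hd : d ≠ 0)
    {F : MvPolynomial (Fin 3) k} (hF : IsSmoothPlaneCurve d F)
    {x y : K} (h0 : aeval ![x, y, 1] F = 0) (hc : eval ![0, 1, 0] F ≠ 0)
    (hx : Transcendental k x) (hxy : IntermediateField.adjoin k {x, y} = ⊤)
    {b : K} (hb : IsIntegral (Algebra.adjoin k {x}) b) :
    ∃ g : ℕ → Polynomial k, b = ∑ i ∈ Finset.range d, Polynomial.aeval x (g i) * y ^ i := by
  obtain ⟨G, hG⟩ := mem_range_of_isIntegral hF h0 hc hx hxy hb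
  change aeval ![x, y, 1] G = b at hG
  let a : Algebra.adjoin k {x} := ⟨x, Algebra.self_mem_adjoin_singleton k x⟩
  set M := monicLine a F with hM
  have hmonic : M.Monic := monicLine_monic hF.1 hc a
  set Q := lineSubst ![a, 0, 1] ![0, 1, 0] G %ₘ M with hQ
  have hdeg : Q.natDegree < d := by
    rw [← monicLine_natDegree hF.1 hc a]
    refine Polynomial.natDegree_modByMonic_lt _ hmonic fun h1 => hd ?_
    rw [← monicLine_natDegree hF.1 hc a, ← hM, h1, Polynomial.natDegree_one]
  have hQb : Polynomial.aeval y Q = b := by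
    have h1 := Polynomial.modByMonic_add_div (lineSubst ![a, 0, 1] ![0, 1, 0] G) M
    have h2 := congrArg (Polynomial.aeval y) h1
    rw [map_add, map_mul, aeval_monicLine a y h0, zero_mul, add_zero,
      aeval_lineSubst_vertical] at h2
    rw [hQ, h2, ← hG]
    rfl
  have hcoeff : ∀ i, ∃ g : Polynomial k, Polynomial.aeval x g = (Q.coeff i : K) :=
    fun i => exists_aeval_eq_of_mem_adjoin (Q.coeff i).2
  choose g hg using hcoeff
  refine ⟨g, ?_⟩
  rw [← hQb, Polynomial.aeval_eq_sum_range' hdeg]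
  simp only [hg, Algebra.smul_def]
  rfl

lemma eq_zero_of_aeval_mul_pow_eq {x : K} (hx : Transcendental k x) {g h : Polynomial k} {m : ℕ}
    (hm : m ≠ 0) (H : Polynomial.aeval x g * x ^ m = Polynomial.aeval x⁻¹ h) : g = 0 := by
  have hx0 : x ≠ 0 := by
    rintro rfl
    exact hx isAlgebraic_zero
  have hrev : Polynomial.aeval x⁻¹ h * x ^ h.natDegree = Polynomial.aeval x h.reverse := by
    let := invertibleOfNonzero (inv_ne_zero hx0)
    have h1 := Polynomial.eval₂_reverse_mul_pow (algebraMap k K) x⁻¹ h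
    rw [invOf_eq_inv, inv_inv] at h1
    rw [Polynomial.aeval_def, Polynomial.aeval_def, ← h1, mul_assoc, ← mul_pow,
      inv_mul_cancel₀ hx0, one_pow, mul_one]
  have heq : g * Polynomial.X ^ (m + h.natDegree) = h.reverse := by
    apply transcendental_iff_injective.mp hx
    rw [map_mul, map_pow, Polynomial.aeval_X, ← hrev, ← H, pow_add, mul_assoc]
  by_contra hg
  have h2 := congrArg Polynomial.natDegree heq
  rw [Polynomial.natDegree_mul hg (pow_ne_zero _ Polynomial.X_ne_zero),
    Polynomial.natDegree_X_pow] at h2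
  have := Polynomial.reverse_natDegree_le h
  omega

/-- If `[K : k(t)] ≤ e`, then `t` satisfies a polynomial relation whose coefficients are polynomials
of degree at most `e` in `x`. -/
lemma exists_polynomial_of_finrank_le {x t : K} (hx : Transcendental k x) {e : ℕ}
    [FiniteDimensional k⟮t⟯ K] (he : Module.finrank k⟮t⟯ K ≤ e) :
    ∃ P : Polynomial K, P ≠ 0 ∧ P.eval t = 0 ∧ ∀ j, P.coeff j ∈ Algebra.adjoin k {x} ∧
      x⁻¹ ^ e * P.coeff j ∈ Algebra.adjoin k {x⁻¹} := by
  have hx0 : x ≠ 0 := by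
    rintro rfl
    exact hx isAlgebraic_zero
  have hdep : ¬ LinearIndependent k⟮t⟯ (fun i : Fin (e + 1) => x ^ (i : ℕ)) := fun h => by
    have := h.fintype_card_le_finrank
    rw [Fintype.card_fin] at this
    omega
  rw [← LinearIndependent.iff_fractionRing (Algebra.adjoin k {t}) k⟮t⟯,
    Fintype.linearIndependent_iff] at hdep
  push Not at hdep
  obtain ⟨m, hm, i₀, hi₀⟩ := hdep
  have hp : ∀ i, ∃ p : Polynomial k, Polynomial.aeval t p = (m i : K) :=
    fun i => exists_aeval_eq_of_mem_adjoin (m i).2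
  choose p hp using hp
  have hcoeff : ∀ j, (∑ i, (p i).map (algebraMap k K) * Polynomial.C (x ^ (i : ℕ))).coeff j =
      ∑ i, algebraMap k K ((p i).coeff j) * x ^ (i : ℕ) := fun j => by
    simp only [Polynomial.finsetSum_coeff, Polynomial.coeff_mul_C, Polynomial.coeff_map]
  refine ⟨∑ i, (p i).map (algebraMap k K) * Polynomial.C (x ^ (i : ℕ)), ?_, ?_, fun j => ?_⟩
  · intro hP
    have hpi : p i₀ ≠ 0 := by
      intro h
      apply hi₀
      ext
      rw [← hp, h, map_zero]
      rfl
    apply hpi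
    ext j
    have h1 := hcoeff j
    rw [hP, Polynomial.coeff_zero] at h1
    have h2 : (∑ i : Fin (e + 1), Polynomial.monomial (i : ℕ) ((p i).coeff j)) = 0 := by
      apply transcendental_iff_injective.mp hx
      rw [map_sum, map_zero, h1]
      exact Finset.sum_congr rfl fun i _ => by rw [Polynomial.aeval_monomial]
    have h3 := congrArg (fun q => Polynomial.coeff q (i₀ : ℕ)) h2
    simpa [Polynomial.finsetSum_coeff, Polynomial.coeff_monomial, Fin.val_inj] using h3
  · rw [Polynomial.eval_finsetSum, ← hm]
    refine Finset.sum_congr rfl fun i _ => ?_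
    rw [Polynomial.eval_mul, Polynomial.eval_C, Polynomial.eval_map_algebraMap, hp]
    rfl
  · rw [hcoeff]
    refine ⟨sum_mem fun i _ => mul_mem (Subalgebra.algebraMap_mem _ _)
      (pow_mem (Algebra.self_mem_adjoin_singleton k x) _), ?_⟩
    rw [Finset.mul_sum]
    refine sum_mem fun i _ => ?_
    have : x⁻¹ ^ e * (algebraMap k K ((p i).coeff j) * x ^ (i : ℕ)) =
        algebraMap k K ((p i).coeff j) * x⁻¹ ^ (e - i) := by
      have hi : (i : ℕ) ≤ e := Nat.lt_succ_iff.mp i.2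
      have h1 : x⁻¹ ^ e = x⁻¹ ^ (e - i) * x⁻¹ ^ (i : ℕ) := by rw [← pow_add, Nat.sub_add_cancel hi]
      have h2 : x⁻¹ ^ (i : ℕ) * x ^ (i : ℕ) = 1 := by
        rw [← mul_pow, inv_mul_cancel₀ hx0, one_pow]
      rw [h1]
      linear_combination (algebraMap k K ((p i).coeff j) * x⁻¹ ^ (e - i)) * h2
    rw [this]
    exact mul_mem (Subalgebra.algebraMap_mem _ _)
      (pow_mem (Algebra.self_mem_adjoin_singleton k x⁻¹) _)

lemma aeval_mem_adjoin_simple (x : K) (g : Polynomial k) : Polynomial.aeval x g ∈ k⟮x⟯ :=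
  algebra_adjoin_le_adjoin k {x} (Polynomial.aeval_mem_adjoin_singleton k x)

lemma transcendental_inv {x : K} (hx : Transcendental k x) : Transcendental k x⁻¹ :=
  fun h => hx (by simpa using h.inv)

lemma adjoin_inv_mul_inv_eq_top {x y : K} (hx0 : x ≠ 0)
    (hxy : IntermediateField.adjoin k {x, y} = ⊤) :
    IntermediateField.adjoin k {x⁻¹, y * x⁻¹} = ⊤ := by
  rw [← top_le_iff, ← hxy, adjoin_le_iff]
  have hx' : x ∈ IntermediateField.adjoin k {x⁻¹, y * x⁻¹} := by
    rw [← inv_inv x]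
    exact inv_mem (subset_adjoin _ _ (by simp))
  have hy' : y ∈ IntermediateField.adjoin k {x⁻¹, y * x⁻¹} := by
    have := mul_mem (subset_adjoin k {x⁻¹, y * x⁻¹} (by simp : y * x⁻¹ ∈ _)) hx'
    rwa [inv_mul_cancel_right₀ hx0] at this
  rintro z (rfl | rfl)
  exacts [hx', hy']

/-- A function that is integral over `k[x]` and has a pole of order at most `e ≤ d - 2` along the
line at infinity has no component along `y ^ (d - 1)`. -/
lemma mem_span_of_isIntegral [CharZero k] {d e : ℕ} (hed : e + 2 ≤ d)
    {F : MvPolynomial (Fin 3) k} (hF : IsSmoothPlaneCurve d F)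
    {x y : K} (h0 : aeval ![x, y, 1] F = 0) (hc : eval ![0, 1, 0] F ≠ 0)
    (hx : Transcendental k x) (hxy : IntermediateField.adjoin k {x, y} = ⊤)
    (hli : LinearIndependent k⟮x⟯ (fun i : Fin d => y ^ (i : ℕ)))
    {b : K} (hb : IsIntegral (Algebra.adjoin k {x}) b)
    (hb' : IsIntegral (Algebra.adjoin k {x⁻¹}) (x⁻¹ ^ e * b)) :
    b ∈ Submodule.span k⟮x⟯ (Set.range fun i : Fin (d - 1) => y ^ (i : ℕ)) := by
  have hx0 : x ≠ 0 := by
    rintro rfl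
    exact hx isAlgebraic_zero
  have hF' : IsSmoothPlaneCurve d (linSubst (swapXZ k) F) := hF.linSubst isUnit_det_swapXZ
  have h0' : aeval ![x⁻¹, y * x⁻¹, 1] (linSubst (swapXZ k) F) = 0 := by
    rw [aeval_linSubst_swapXZ, ← mul_zero (x⁻¹ ^ d), ← h0, ← aeval_mul_of_isHomogeneous hF.1]
    congr 2
    ext i
    fin_cases i <;> simp [hx0, mul_comm]
  have hc' : eval ![0, 1, 0] (linSubst (swapXZ k) F) ≠ 0 := by
    rwa [eval_eq_aeval, aeval_linSubst_swapXZ, ← eval_eq_aeval]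
  obtain ⟨g, hg⟩ := exists_eq_sum_of_isIntegral (by omega) hF h0 hc hx hxy hb
  obtain ⟨h, hh⟩ := exists_eq_sum_of_isIntegral (by omega) hF' h0' hc' (transcendental_inv hx)
    (adjoin_inv_mul_inv_eq_top hx0 hxy) hb'
  have hxinv : x⁻¹ ∈ k⟮x⟯ := inv_mem (mem_adjoin_simple_self k x)
  have hinv : ∀ p : Polynomial k, Polynomial.aeval x⁻¹ p ∈ k⟮x⟯ := fun p =>
    adjoin_le_iff.mpr (by rintro _ rfl; exact hxinv) (aeval_mem_adjoin_simple x⁻¹ p)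
  let c : ℕ → k⟮x⟯ := fun i => ⟨x⁻¹ ^ e * Polynomial.aeval x (g i) -
    Polynomial.aeval x⁻¹ (h i) * x⁻¹ ^ i, sub_mem
      (mul_mem (pow_mem hxinv _) (aeval_mem_adjoin_simple x _))
      (mul_mem (hinv _) (pow_mem hxinv _))⟩
  have hsum : ∑ i : Fin d, c i • y ^ (i : ℕ) = 0 := by
    rw [Finset.sum_range (fun i => _)] at hg hh
    rw [hg, Finset.mul_sum, ← sub_eq_zero, ← Finset.sum_sub_distrib] at hh
    rw [← hh]
    refine Finset.sum_congr rfl fun i _ => ?_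
    rw [Algebra.smul_def]
    change (x⁻¹ ^ e * Polynomial.aeval x (g i) -
      Polynomial.aeval x⁻¹ (h i) * x⁻¹ ^ (i : ℕ)) * y ^ (i : ℕ) = _
    ring
  have hlast := Fintype.linearIndependent_iff.mp hli (fun i => c i) hsum ⟨d - 1, by omega⟩
  have hlast' : x⁻¹ ^ e * Polynomial.aeval x (g (d - 1)) -
      Polynomial.aeval x⁻¹ (h (d - 1)) * x⁻¹ ^ (d - 1) = 0 := congrArg Subtype.val hlast
  have hgd : g (d - 1) = 0 := by
    refine eq_zero_of_aeval_mul_pow_eq (m := d - 1 - e) (h := h (d - 1)) hx (by omega) ?_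
    have h1 : x⁻¹ ^ (d - 1) = x⁻¹ ^ (d - 1 - e) * x⁻¹ ^ e := by
      rw [← pow_add, Nat.sub_add_cancel (by omega)]
    have h2 : x⁻¹ ^ (d - 1 - e) * x ^ (d - 1 - e) = 1 := by
      rw [← mul_pow, inv_mul_cancel₀ hx0, one_pow]
    have h3 : x⁻¹ ^ e ≠ 0 := pow_ne_zero _ (inv_ne_zero hx0)
    apply mul_left_cancel₀ h3
    rw [h1] at hlast'
    linear_combination x ^ (d - 1 - e) * hlast' +
      Polynomial.aeval x⁻¹ (h (d - 1)) * x⁻¹ ^ e * h2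
  obtain ⟨d', rfl⟩ : ∃ d', d = d' + 1 := ⟨d - 1, by omega⟩
  rw [Nat.add_sub_cancel] at hgd ⊢
  rw [hg, Finset.sum_range_succ, hgd, map_zero, zero_mul, add_zero]
  refine sum_mem fun i hi => ?_
  have := Submodule.smul_mem (Submodule.span k⟮x⟯ (Set.range fun i : Fin d' => y ^ (i : ℕ)))
    ⟨_, aeval_mem_adjoin_simple x (g i)⟩
    (Submodule.subset_span ⟨⟨i, Finset.mem_range.mp hi⟩, rfl⟩)
  exact this

lemma iterate_divX_C_mul (a : K) (P : Polynomial K) (j : ℕ) :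
    Polynomial.divX^[j] (Polynomial.C a * P) = Polynomial.C a * Polynomial.divX^[j] P := by
  induction j with
  | zero => rfl
  | succ j ih => rw [Function.iterate_succ_apply', ih, Polynomial.divX_C_mul,
      Function.iterate_succ_apply']

/-- If the coefficients of `P ≠ 0` lie in `L` and `P t = 0`, then the `L`-span of the values at `t`
of the Horner truncations of `P` contains `L[t]`. -/
lemma adjoin_le_span_eval_iterate_divX {L : IntermediateField k K} {P : Polynomial K}
    (hP : P ≠ 0) (hPL : ∀ i, P.coeff i ∈ L) {t : K} (ht : P.eval t = 0) :
    ∀ b ∈ Algebra.adjoin L {t},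
      b ∈ Submodule.span L (Set.range fun j => (Polynomial.divX^[j] P).eval t) := by
  set n : ℕ → K := fun j => (Polynomial.divX^[j] P).eval t with hn
  set S := Submodule.span L (Set.range n) with hS
  have hcoeff : ∀ j i, (Polynomial.divX^[j] P).coeff i = P.coeff (i + j) := by
    intro j
    induction j with
    | zero => simp
    | succ j ih =>
      intro i
      rw [Function.iterate_succ_apply', Polynomial.coeff_divX, ih, add_assoc, add_comm 1]
  have hrec : ∀ j, n (j + 1) * t + P.coeff j = n j := by
    intro j
    have h1 := congrArg (Polynomial.eval t) (Polynomial.divX_mul_X_add (Polynomial.divX^[j] P))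
    rw [Polynomial.eval_add, Polynomial.eval_mul, Polynomial.eval_X, Polynomial.eval_C, hcoeff,
      zero_add, ← Function.iterate_succ_apply' Polynomial.divX] at h1
    exact h1
  have hnS : ∀ j, n j ∈ S := fun j => Submodule.subset_span ⟨j, rfl⟩
  have h1S : (1 : K) ∈ S := by
    have hlead : n P.natDegree = P.leadingCoeff := by
      have : Polynomial.divX^[P.natDegree] P = Polynomial.C P.leadingCoeff := by
        ext i
        rw [hcoeff, Polynomial.coeff_C]
        split_ifs with hi
        · rw [hi, zero_add, Polynomial.leadingCoeff]
        · exact Polynomial.coeff_eq_zero_of_natDegree_lt (by omega)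
      simp only [hn, this, Polynomial.eval_C]
    have h2 := S.smul_mem (⟨P.leadingCoeff, hPL _⟩ : L)⁻¹ (hnS P.natDegree)
    rw [hlead] at h2
    convert h2 using 1
    exact (inv_mul_cancel₀ (Polynomial.leadingCoeff_ne_zero.mpr hP)).symm
  have hconst : ∀ j, P.coeff j ∈ S := fun j => by
    have := S.smul_mem (⟨P.coeff j, hPL j⟩ : L) h1S
    convert this using 1
    exact (mul_one (P.coeff j)).symm
  have hmul : ∀ b ∈ S, b * t ∈ S := by
    intro b hb
    induction hb using Submodule.span_induction with
    | mem b hb =>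
      obtain ⟨j, rfl⟩ := hb
      cases j with
      | zero =>
        rw [show n 0 = 0 from ht, zero_mul]
        exact S.zero_mem
      | succ j =>
        rw [← add_sub_cancel_right (n (j + 1) * t) (P.coeff j), hrec]
        exact S.sub_mem (hnS j) (hconst j)
    | zero => simp
    | add a b _ _ ha hb =>
      rw [add_mul]
      exact S.add_mem ha hb
    | smul c b _ hb =>
      rw [smul_mul_assoc]
      exact S.smul_mem c hb
  have hpow : ∀ i, t ^ i ∈ S := by
    intro i
    induction i with
    | zero => simpa using h1S
    | succ i ih => exact pow_succ t i ▸ hmul _ ih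
  intro b hb
  obtain ⟨p, rfl⟩ := exists_aeval_eq_of_mem_adjoin hb
  rw [Polynomial.aeval_eq_sum_range]
  exact sum_mem fun i _ => S.smul_mem _ (hpow i)

/-- **Noether's bound**: a function `t` on a smooth plane curve of degree `d` which generates the
function field together with `x` has degree at least `d - 1`. -/
lemma le_finrank_add_one [CharZero k] {d : ℕ}
    {F : MvPolynomial (Fin 3) k} (hF : IsSmoothPlaneCurve d F)
    {x y : K} (h0 : aeval ![x, y, 1] F = 0) (hc : eval ![0, 1, 0] F ≠ 0)
    (hx : Transcendental k x) (hxy : IntermediateField.adjoin k {x, y} = ⊤)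
    (hli : LinearIndependent k⟮x⟯ (fun i : Fin d => y ^ (i : ℕ)))
    {t : K} [FiniteDimensional k⟮t⟯ K] (hxt : IntermediateField.adjoin k {x, t} = ⊤) :
    d ≤ Module.finrank k⟮t⟯ K + 1 := by
  by_contra! hlt
  obtain ⟨P, hP, hPt, hPcoeff⟩ := exists_polynomial_of_finrank_le hx (le_refl (Module.finrank k⟮t⟯ K))
  have hPL : ∀ i, P.coeff i ∈ k⟮x⟯ := fun i => algebra_adjoin_le_adjoin k {x} (hPcoeff i).1
  have hmem : ∀ j, (Polynomial.divX^[j] P).eval t ∈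
      Submodule.span k⟮x⟯ (Set.range fun i : Fin (d - 1) => y ^ (i : ℕ)) := by
    intro j
    refine mem_span_of_isIntegral (e := Module.finrank k⟮t⟯ K) (by omega) hF h0 hc hx hxy hli
      (isIntegral_eval_iterate_divX P (fun i => ?_) t hPt j) ?_
    · exact isIntegral_algebraMap (x := (⟨_, (hPcoeff i).1⟩ : Algebra.adjoin k {x}))
    · rw [← Polynomial.eval_C_mul, ← iterate_divX_C_mul]
      refine isIntegral_eval_iterate_divX _ (fun i => ?_) t
        (by rw [Polynomial.eval_C_mul, hPt, mul_zero]) j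
      rw [Polynomial.coeff_C_mul]
      exact isIntegral_algebraMap (x := (⟨_, (hPcoeff i).2⟩ : Algebra.adjoin k {x⁻¹}))
  have htint : IsIntegral k⟮x⟯ t := by
    apply IsAlgebraic.isIntegral
    have hlift : P ∈ Polynomial.lifts (algebraMap k⟮x⟯ K) := by
      rw [Polynomial.lifts_iff_coeff_lifts]
      exact fun i => ⟨⟨_, hPL i⟩, rfl⟩
    obtain ⟨Q, hQ⟩ := hlift
    rw [Polynomial.coe_mapRingHom] at hQ
    refine ⟨Q, ?_, ?_⟩
    · rintro rfl
      exact hP (by rw [← hQ, Polynomial.map_zero])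
    · rw [← Polynomial.eval_map_algebraMap, hQ, hPt]
  have htop : Submodule.span k⟮x⟯ (Set.range fun i : Fin (d - 1) => y ^ (i : ℕ)) = ⊤ := by
    rw [← top_le_iff]
    intro b _
    have hb : b ∈ Algebra.adjoin k⟮x⟯ {t} := by
      rw [algebraAdjoin_simple_eq_top hxt htint]
      exact Algebra.mem_top
    refine Submodule.span_le.mpr ?_ (adjoin_le_span_eval_iterate_divX hP hPL hPt b hb)
    rintro _ ⟨j, rfl⟩
    exact hmem j
  have : FiniteDimensional k⟮x⟯ K := ⟨htop ▸ Submodule.fg_span (Set.finite_range _)⟩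
  have h1 := hli.fintype_card_le_finrank
  have h2 := finrank_range_le_card (R := k⟮x⟯) (fun i : Fin (d - 1) => y ^ (i : ℕ))
  rw [Set.finrank, htop, finrank_top, Fintype.card_fin] at h2
  rw [Fintype.card_fin] at h1
  omega

end Noether

section GenericCoordinate

open IntermediateField algebraAdjoinAdjoin

variable {k K : Type} [Field k] [Field K] [Algebra k K]

/-- A smooth plane curve does not contain the line `Z = 0`. -/
lemma lineSubst_infinity_ne_zero [CharZero k] {d : ℕ} (hd : 2 ≤ d) {F : MvPolynomial (Fin 3) k}
    (hF : IsSmoothPlaneCurve d F) :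
    (lineSubst ![0, 1, 0] ![1, 0, 0] F : Polynomial k) ≠ 0 := by
  intro hzero
  let L : MvPolynomial (Fin 3) k → Polynomial k := lineSubst ![0, 1, 0] ![1, 0, 0]
  have hX : L (pderiv 0 F) = 0 := by
    have h := derivative_lineSubst (A := k) ![0, 1, 0] ![1, 0, 0] F
    rw [hzero, Fin.sum_univ_three] at h
    simpa [L] using h.symm
  have hY : L (pderiv 1 F) = 0 := by
    have h : L (∑ i, X i * pderiv i F) = L (d • F) := congrArg L hF.1.sum_X_mul_pderiv
    have hmul : ∀ G H, L (G * H) = L G * L H := fun G H => by simp only [L, lineSubst, map_mul]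
    have hadd : ∀ G H, L (G + H) = L G + L H := fun G H => by simp only [L, lineSubst, map_add]
    have hF0 : L (d • F) = 0 := by
      have : L (d • F) = d • L F := by simp only [L, lineSubst, map_nsmul]
      rw [this, show L F = 0 from hzero, smul_zero]
    have h1 : L (X 1) = 1 := by simp [L, lineSubst]
    have h2 : L (X 2) = 0 := by simp [L, lineSubst]
    rw [Fin.sum_univ_three, hF0, hadd, hadd, hmul, hmul, hmul, hX, h1, h2] at h
    simpa using h
  have hcoeff : ∀ i, (L (pderiv i F)).natDegree ≤ d - 1 ∧
      (L (pderiv i F)).coeff (d - 1) = eval ![1, 0, 0] (pderiv i F) := fun i =>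
    natDegree_lineSubst_le_and_coeff hF.1.pderiv _ _
  have hZ : (L (pderiv 2 F)).degree = 0 := by
    by_contra hdeg
    obtain ⟨s, hs⟩ := IsAlgClosed.exists_aeval_eq_zero (AlgebraicClosure k) _ hdeg
    have hP : ∀ i, aeval ![s, 1, 0] (pderiv i F) = Polynomial.aeval s (L (pderiv i F)) := by
      intro i
      rw [aeval_lineSubst]
      congr 2
      ext j
      fin_cases j <;> simp
    obtain ⟨i, hi⟩ := hF.exists_aeval_pderiv_ne_zero (P := ![s, 1, 0])
      (fun h => one_ne_zero (congrFun h 1))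
    rw [hP] at hi
    fin_cases i
    · exact hi (by simp [hX])
    · exact hi (by simp [hY])
    · exact hi hs
  obtain ⟨i, hi⟩ := hF.exists_eval_pderiv_ne_zero (P := ![1, 0, 0])
    (fun h => one_ne_zero (congrFun h 0))
  rw [← (hcoeff i).2] at hi
  fin_cases i
  · exact hi (by simp [hX])
  · exact hi (by simp [hY])
  · exact hi (Polynomial.coeff_eq_zero_of_degree_lt (by
      change (L (pderiv 2 F)).degree < _
      rw [hZ]
      exact_mod_cast (by omega : 0 < d - 1)))

lemma infinite_setOf_eval_ne_zero [CharZero k] {d : ℕ} (hd : 2 ≤ d) {F : MvPolynomial (Fin 3) k}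
    (hF : IsSmoothPlaneCurve d F) : {c : k | eval ![-c, 1, 0] F ≠ 0}.Infinite := by
  set g : Polynomial k := lineSubst ![0, 1, 0] ![1, 0, 0] F with hg
  have hev : ∀ c, g.eval (-c) = eval ![-c, 1, 0] F := by
    intro c
    rw [← Polynomial.coe_aeval_eq_eval, hg, aeval_lineSubst, eval_eq_aeval]
    congr 2
    ext i
    fin_cases i <;> simp
  have hfin : {c : k | eval ![-c, 1, 0] F = 0}.Finite := by
    refine ((Polynomial.finite_setOfPred_isRoot (lineSubst_infinity_ne_zero hd hF)).preimage
      (f := fun c => -c) neg_injective.injOn).subset fun c hc => ?_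
    exact (hev c).trans hc
  exact hfin.infinite_compl

/-- `1, y, …, y ^ (d - 1)` are independent over `k[x + c y]` when the point `(-c : 1 : 0)` is not on
the curve. -/
lemma eq_zero_of_sum_aeval_mul_pow_eq_zero {d : ℕ} {F : MvPolynomial (Fin 3) k}
    (hF : F.IsHomogeneous d) {x y : K}
    (hker : ∀ q : MvPolynomial (Fin 2) k, aeval ![x, y] q = 0 →
      (aeval ![X 0, X 1, 1] F : MvPolynomial (Fin 2) k) ∣ q)
    {c : k} (hc : eval ![-c, 1, 0] F ≠ 0) (g : Fin d → Polynomial k)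
    (hg : ∑ i, Polynomial.aeval (x + algebraMap k K c * y) (g i) * y ^ (i : ℕ) = 0) (i : Fin d) :
    g i = 0 := by
  have hdvd := hker (∑ i, Polynomial.aeval (X 0 + C c * X 1 : MvPolynomial (Fin 2) k) (g i) *
      X 1 ^ (i : ℕ)) (by
    rw [← hg, map_sum]
    refine Finset.sum_congr rfl fun i _ => ?_
    rw [map_mul, map_pow, ← Polynomial.aeval_algHom_apply]
    simp)
  let ψ : MvPolynomial (Fin 2) k →ₐ[k] Polynomial (Polynomial k) :=
    aeval ![Polynomial.C Polynomial.X - Polynomial.C (Polynomial.C c) * Polynomial.X, Polynomial.X]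
  have hψF : ψ (aeval ![X 0, X 1, 1] F) = lineSubst ![Polynomial.X, 0, 1] ![-c, 1, 0] F := by
    rw [lineSubst, ← AlgHom.comp_apply, comp_aeval]
    congr 2
    ext1 i
    fin_cases i <;> simp [ψ, sub_eq_add_neg]
  have hψg : ∀ p : Polynomial k, ψ (Polynomial.aeval (X 0 + C c * X 1) p) = Polynomial.C p := by
    intro p
    rw [← Polynomial.aeval_algHom_apply]
    have h1 : ψ (X 0 + C c * X 1) = Polynomial.C Polynomial.X := by
      simp [ψ, ← algebraMap_eq, IsScalarTower.algebraMap_apply k (Polynomial k)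
        (Polynomial (Polynomial k))]
    rw [h1]
    have h2 := Polynomial.aeval_algHom_apply
      (IsScalarTower.toAlgHom k (Polynomial k) (Polynomial (Polynomial k))) Polynomial.X p
    rw [Polynomial.aeval_X_left_apply] at h2
    exact h2
  have hψ := map_dvd ψ hdvd
  rw [hψF, map_sum] at hψ
  simp only [map_mul, map_pow, hψg] at hψ
  have hX : ψ (X 1) = Polynomial.X := by simp [ψ]
  rw [hX] at hψ
  obtain ⟨hdeg, hlead⟩ :=
    natDegree_lineSubst_le_and_coeff hF (![Polynomial.X, 0, 1] : Fin 3 → Polynomial k) ![-c, 1, 0]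
  have hdeg' := Polynomial.natDegree_eq_of_le_of_coeff_ne_zero hdeg (by
    rw [hlead]
    simpa using hc)
  have hd : 0 < d := i.pos
  have hlt : (∑ i : Fin d, Polynomial.C (g i) * Polynomial.X ^ (i : ℕ)).natDegree < d := by
    refine lt_of_le_of_lt (Polynomial.natDegree_sum_le_of_forall_le (n := d - 1) _ _
      fun i _ => ?_) (by omega)
    exact (Polynomial.natDegree_C_mul_X_pow_le _ _).trans (by omega)
  have hzero := Polynomial.eq_zero_of_dvd_of_natDegree_lt hψ (by rw [hdeg']; exact hlt)
  have := congrArg (fun q => Polynomial.coeff q (i : ℕ)) hzero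
  simpa [Polynomial.finsetSum_coeff, Polynomial.coeff_X_pow, Fin.val_inj] using this

lemma linearIndependent_pow_of_sum_eq_zero {d : ℕ} {x y : K}
    (h : ∀ g : Fin d → Polynomial k,
      ∑ i, Polynomial.aeval x (g i) * y ^ (i : ℕ) = 0 → ∀ i, g i = 0) :
    LinearIndependent k⟮x⟯ (fun i : Fin d => y ^ (i : ℕ)) := by
  rw [← LinearIndependent.iff_fractionRing (Algebra.adjoin k {x}) k⟮x⟯,
    Fintype.linearIndependent_iff]
  intro m hm i
  have hp : ∀ i, ∃ p : Polynomial k, Polynomial.aeval x p = (m i : K) :=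
    fun i => exists_aeval_eq_of_mem_adjoin (m i).2
  choose p hp using hp
  have := h p (by simp only [hp]; exact hm) i
  ext
  rw [← hp, this, map_zero]
  rfl

lemma transcendental_of_sum_eq_zero {d : ℕ} (hd : 0 < d) {x y : K}
    (h : ∀ g : Fin d → Polynomial k,
      ∑ i, Polynomial.aeval x (g i) * y ^ (i : ℕ) = 0 → ∀ i, g i = 0) : Transcendental k x := by
  rintro ⟨p, hp0, hp⟩
  refine hp0 ?_
  have := h (fun i => if i = ⟨0, hd⟩ then p else 0) (by
    rw [Finset.sum_eq_single ⟨0, hd⟩]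
    · simp [hp]
    · intro i _ hi
      simp [hi]
    · simp) ⟨0, hd⟩
  simpa using this

/-- In a function field of one variable, every nonconstant function has finite degree. -/
lemma finiteDimensional_of_transcendental {x y t : K}
    (hxy : IntermediateField.adjoin k {x, y} = ⊤) (hy : IsIntegral (Algebra.adjoin k {x}) y)
    (ht : Transcendental k t) : FiniteDimensional k⟮t⟯ K := by
  have hyx : IsIntegral k⟮x⟯ y := hy.tower_top
  have hfin : FiniteDimensional k⟮x⟯ K := by
    have := adjoin.finiteDimensional hyx
    rw [adjoin_simple_eq_top hxy] at this
    exact topEquiv.toLinearEquiv.finiteDimensional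
  have halg : Algebra.IsAlgebraic (Algebra.adjoin k {x}) K :=
    isAlgebraic_adjoin_iff_top.mp inferInstance
  have htr : Algebra.trdeg k K ≤ 1 := by
    simpa using Algebra.IsAlgebraic.trdeg_le_cardinalMk k ({x} : Set K)
  have hbasis : IsTranscendenceBasis k (fun _ : Unit => t) := by
    refine AlgebraicIndependent.isTranscendenceBasis_of_trdeg_le_of_finite ?_ (by simpa using htr)
    rwa [algebraicIndependent_unique_type_iff]
  have halgt : Algebra.IsAlgebraic k⟮t⟯ K := by
    have := hbasis.isAlgebraic_field
    rwa [Set.range_const] at this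
  have := finiteDimensional_adjoin_pair (K := k⟮t⟯) (halgt.isAlgebraic x).isIntegral
    (halgt.isAlgebraic y).isIntegral
  have htop : IntermediateField.adjoin k⟮t⟯ {x, y} = ⊤ := by
    rw [← restrictScalars_eq_top_iff (K := k), ← top_le_iff, ← hxy, adjoin_le_iff]
    exact subset_adjoin k⟮t⟯ {x, y}
  rw [htop] at this
  exact topEquiv.toLinearEquiv.finiteDimensional

/-- Among infinitely many functions `x + c y`, one generates the function field together with
`t`. -/
lemma exists_adjoin_pair_eq_top [CharZero k] {x y t : K}
    (hxy : IntermediateField.adjoin k {x, y} = ⊤) [FiniteDimensional k⟮t⟯ K]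
    {s : Set k} (hs : s.Infinite) :
    ∃ c ∈ s, IntermediateField.adjoin k {x + algebraMap k K c * y, t} = ⊤ := by
  have : CharZero k⟮t⟯ := charZero_of_injective_algebraMap (algebraMap k k⟮t⟯).injective
  have : Finite (IntermediateField k⟮t⟯ K) :=
    Field.finite_intermediateField_of_exists_primitive_element k⟮t⟯ K
      (Field.exists_primitive_element k⟮t⟯ K)
  obtain ⟨c, hc, c', -, hne, heq⟩ := hs.exists_ne_map_eq_of_mapsTo
    (f := fun c => k⟮t⟯⟮x + algebraMap k K c * y⟯) (t := Set.univ) (fun _ _ => Set.mem_univ _)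
    Set.finite_univ
  refine ⟨c, hc, ?_⟩
  set M := k⟮t⟯⟮x + algebraMap k K c * y⟯ with hM
  have hk : ∀ a : k, algebraMap k K a ∈ M := fun a => by
    rw [IsScalarTower.algebraMap_apply k k⟮t⟯ K]
    exact M.algebraMap_mem _
  have h1 : x + algebraMap k K c * y ∈ M := mem_adjoin_simple_self _ _
  have h2 : x + algebraMap k K c' * y ∈ M := by
    have h : M = k⟮t⟯⟮x + algebraMap k K c' * y⟯ := heq
    rw [h]
    exact mem_adjoin_simple_self _ _
  have hy : y ∈ M := by
    have h3 := mul_mem (hk (c - c')⁻¹) (sub_mem h1 h2)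
    have hcc : algebraMap k K (c - c') ≠ 0 := by simpa [sub_eq_zero] using hne
    have h4 : algebraMap k K (c - c')⁻¹ * (x + algebraMap k K c * y -
        (x + algebraMap k K c' * y)) = y := by
      rw [map_inv₀, inv_mul_eq_iff_eq_mul₀ hcc, map_sub]
      ring
    rwa [h4] at h3
  have hx : x ∈ M := by simpa using sub_mem h1 (mul_mem (hk c) hy)
  have hMtop : M.restrictScalars k = ⊤ := by
    rw [← top_le_iff, ← hxy, adjoin_le_iff]
    rintro z (rfl | rfl)
    exacts [hx, hy]
  rwa [hM, adjoin_simple_adjoin_simple, Set.pair_comm] at hMtop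

/-- The function field of a smooth plane curve of degree `d` has gonality at least `d - 1`, for a
field `K` generated by `x, y` subject only to the affine equation of the curve. -/
lemma le_gonality_add_one [CharZero k] {d : ℕ} (hd : 2 ≤ d) {F : MvPolynomial (Fin 3) k}
    (hF : IsSmoothPlaneCurve d F) {x y : K} (h0 : aeval ![x, y, 1] F = 0)
    (hxy : IntermediateField.adjoin k {x, y} = ⊤)
    (hker : ∀ q : MvPolynomial (Fin 2) k, aeval ![x, y] q = 0 →
      (aeval ![X 0, X 1, 1] F : MvPolynomial (Fin 2) k) ∣ q) :
    d ≤ gonality k K + 1 := by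
  have hF' : ∀ c, IsSmoothPlaneCurve d (linSubst (shear c) F) := fun c =>
    hF.linSubst (by rw [det_shear]; exact isUnit_one)
  have h0' : ∀ c, aeval ![x + algebraMap k K c * y, y, 1] (linSubst (shear c) F) = 0 := fun c => by
    rw [aeval_linSubst_shear, add_sub_cancel_right, h0]
  have hc' : ∀ c, eval ![-c, 1, 0] F ≠ 0 → eval ![0, 1, 0] (linSubst (shear c) F) ≠ 0 :=
    fun c hc => by
      rw [eval_linSubst_shear]
      simpa using hc
  have hindep := fun c (hc : eval ![-c, 1, 0] F ≠ 0) =>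
    eq_zero_of_sum_aeval_mul_pow_eq_zero hF.1 hker hc
  have htr := fun c hc => transcendental_of_sum_eq_zero (by omega) (hindep c hc)
  have hinf := infinite_setOf_eval_ne_zero hd hF
  suffices d - 1 ≤ gonality k K by omega
  obtain ⟨c₀, hc₀⟩ := hinf.nonempty
  refine le_csInf ⟨_, _, htr c₀ hc₀, rfl⟩ ?_
  rintro _ ⟨t, ht, rfl⟩
  have := finiteDimensional_of_transcendental (adjoin_shear_eq_top hxy c₀)
    (isIntegral_of_eval_ne_zero (hF' c₀).1 (h0' c₀) (hc' c₀ hc₀)) ht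
  obtain ⟨c, hc, htop⟩ := exists_adjoin_pair_eq_top (t := t) hxy hinf
  have := le_finrank_add_one (hF' c) (h0' c) (hc' c hc) (htr c hc) (adjoin_shear_eq_top hxy c)
    (linearIndependent_pow_of_sum_eq_zero (hindep c hc)) htop
  omega

lemma le_gonality_fractionRing_add_one [CharZero k] {d : ℕ} (hd : 2 ≤ d)
    {F : MvPolynomial (Fin 3) k} (hF : IsSmoothPlaneCurve d F) [IsDomain (PlaneCurveRing k F)] :
    d ≤ gonality k (FractionRing (PlaneCurveRing k F)) + 1 := by
  set K := FractionRing (PlaneCurveRing k F)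
  let φ : MvPolynomial (Fin 2) k →ₐ[k] K :=
    (IsScalarTower.toAlgHom k (PlaneCurveRing k F) K).comp (Ideal.Quotient.mkₐ k _)
  have hφ : φ = aeval ![φ (X 0), φ (X 1)] := by
    ext i
    fin_cases i <;> simp
  have hφker : ∀ q, φ q = 0 ↔ (aeval ![X 0, X 1, 1] F : MvPolynomial (Fin 2) k) ∣ q := by
    intro q
    rw [← Ideal.mem_span_singleton, ← Ideal.Quotient.eq_zero_iff_mem]
    exact map_eq_zero_iff _ (IsFractionRing.injective (PlaneCurveRing k F) K)
  refine le_gonality_add_one (x := φ (X 0)) (y := φ (X 1)) hd hF ?_ ?_ fun q hq => ?_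
  · rw [← (hφker _).mpr dvd_rfl, ← AlgHom.comp_apply, comp_aeval]
    congr 2
    ext i
    fin_cases i <;> simp
  · rw [← top_le_iff]
    intro z _
    have hmem : ∀ r : PlaneCurveRing k F, algebraMap _ K r ∈
        IntermediateField.adjoin k {φ (X 0), φ (X 1)} := by
      intro r
      obtain ⟨q, rfl⟩ := Ideal.Quotient.mk_surjective r
      refine algebra_adjoin_le_adjoin k _ ?_
      change φ q ∈ _
      have : φ q ∈ (aeval ![φ (X 0), φ (X 1)] : MvPolynomial (Fin 2) k →ₐ[k] K).range :=
        ⟨q, (DFunLike.congr_fun hφ q).symm⟩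
      rwa [← Algebra.adjoin_range_eq_range_aeval, Matrix.range_cons_cons_empty] at this
    obtain ⟨a, b, -, rfl⟩ := IsFractionRing.div_surjective (PlaneCurveRing k F) z
    exact div_mem (hmem a) (hmem b)
  · rwa [← hφker, hφ]

end GenericCoordinate

section Progression

open IntermediateField

variable {k : Type} [Field k]

lemma exists_generalLinearGroup_col_eq {q : Fin 3 → k} {j : Fin 3} (hj : q j = 1) :
    ∃ A : GL (Fin 3) k, ∀ i, (A : Matrix (Fin 3) (Fin 3) k) i 2 = q i := by
  suffices ∃ A : Matrix (Fin 3) (Fin 3) k, IsUnit A.det ∧ ∀ i, A i 2 = q i by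
    obtain ⟨A, hA, h⟩ := this
    exact ⟨Matrix.GeneralLinearGroup.mk'' A hA, h⟩
  fin_cases j
  · refine ⟨!![0, 0, q 0; 1, 0, q 1; 0, 1, q 2], ?_, fun i => by fin_cases i <;> rfl⟩
    simp_all [Matrix.det_fin_three]
  · refine ⟨!![1, 0, q 0; 0, 0, q 1; 0, 1, q 2], ?_, fun i => by fin_cases i <;> rfl⟩
    simp_all [Matrix.det_fin_three]
  · refine ⟨!![1, 0, q 0; 0, 1, q 1; 0, 0, q 2], ?_, fun i => by fin_cases i <;> rfl⟩
    simp_all [Matrix.det_fin_three]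

/-- The lines through a rational point `(0 : 0 : 1)` of a smooth plane curve of degree `d` cut out
residual points of degree at most `d - 1`; only the tangent line may fail to have one. -/
lemma exists_forall_ne_exists_aeval_eq_zero [CharZero k] {d : ℕ} (hd : 2 ≤ d)
    {F : MvPolynomial (Fin 3) k} (hF : IsSmoothPlaneCurve d F) (h0 : eval ![0, 0, 1] F = 0) :
    ∃ x₀ : k, ∀ x ≠ x₀, ∃ z : AlgebraicClosure k,
      aeval ![algebraMap k _ x, 1, z] F = 0 ∧ Module.finrank k k⟮z⟯ ≤ d - 1 := by
  obtain ⟨m, rfl⟩ := Nat.exists_eq_add_of_le' hd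
  set a : Fin 3 → k := fun i => eval ![0, 0, 1] (pderiv i F) with ha
  have ha2 : a 2 = 0 := by
    have h := congrArg (eval ![0, 0, 1]) hF.1.sum_X_mul_pderiv
    simpa [Fin.sum_univ_three, h0] using h
  have ha01 : a 0 ≠ 0 ∨ a 1 ≠ 0 := by
    by_contra! h
    obtain ⟨i, hi⟩ := hF.exists_eval_pderiv_ne_zero (P := ![0, 0, 1])
      (fun h => one_ne_zero (congrFun h 2))
    fin_cases i
    exacts [hi h.1, hi h.2, hi ha2]
  refine ⟨-a 1 / a 0, fun x hx => ?_⟩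
  have hx' : x * a 0 + a 1 ≠ 0 := by
    intro h
    by_cases h00 : a 0 = 0
    · rw [h00, mul_zero, zero_add] at h
      exact ha01.elim (fun h' => h' h00) (fun h' => h' h)
    · apply hx
      rw [eq_div_iff h00]
      linear_combination h
  set L : MvPolynomial (Fin 3) k →ₐ[k] Polynomial k :=
    aeval (fun i => Polynomial.C ((![x, 1, 0] : Fin 3 → k) i) +
      Polynomial.C (algebraMap k k ((![0, 0, 1] : Fin 3 → k) i)) * Polynomial.X) with hL
  have hLF : ∀ G, L G = lineSubst ![x, 1, 0] ![0, 0, 1] G := fun G => rfl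
  obtain ⟨hdeg, hcoeff⟩ := natDegree_lineSubst_le_and_coeff hF.1 ![x, 1, 0] ![0, 0, 1]
  rw [← hLF] at hdeg hcoeff
  rw [h0, map_zero] at hcoeff
  have hderiv : Polynomial.derivative (L F) = L (pderiv 2 F) := by
    rw [hLF, derivative_lineSubst, Fin.sum_univ_three]
    simp [hLF]
  have hcoeff' : (L F).coeff (m + 1) = x * a 0 + a 1 := by
    have hpd : ∀ i, (L (pderiv i F)).coeff (m + 1) = a i := fun i =>
      (natDegree_lineSubst_le_and_coeff (hF.1.pderiv (i := i)) ![x, 1, 0] ![0, 0, 1]).2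
    have h := congrArg (fun G => (L G).coeff (m + 1)) hF.1.sum_X_mul_pderiv
    have hX0 : L (X 0) = Polynomial.C x := by simp [hL]
    have hX1 : L (X 1) = 1 := by simp [hL]
    have hX2 : L (X 2) = Polynomial.X := by simp [hL]
    simp only [Fin.sum_univ_three, map_add, map_mul, hX0, hX1, hX2, map_nsmul, ← hderiv, one_mul,
      Polynomial.coeff_add, Polynomial.coeff_C_mul, hpd, Polynomial.coeff_X_mul,
      Polynomial.coeff_derivative, Polynomial.coeff_smul] at h
    rw [nsmul_eq_mul] at h
    push_cast at h
    linear_combination -h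
  have hne : L F ≠ 0 := by
    intro h
    apply hx'
    rw [← hcoeff', h, Polynomial.coeff_zero]
  have hdeg0 : (L F).degree ≠ 0 := by
    have := Polynomial.le_degree_of_ne_zero (hcoeff' ▸ hx')
    intro h
    rw [h] at this
    exact absurd this (by exact_mod_cast (by omega : ¬ m + 1 ≤ 0))
  obtain ⟨z, hz⟩ := IsAlgClosed.exists_aeval_eq_zero (AlgebraicClosure k) _ hdeg0
  refine ⟨z, ?_, ?_⟩
  · rw [← hz, hLF, aeval_lineSubst]
    congr 2
    ext i
    fin_cases i <;> simp
  · rw [adjoin.finrank (Algebra.IsIntegral.isIntegral z)]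
    exact (Polynomial.natDegree_le_of_dvd (minpoly.dvd k z hz) hne).trans
      (Polynomial.natDegree_le_pred hdeg hcoeff)

lemma hasInfiniteLevelProg_of_forall_exists {F : MvPolynomial (Fin 3) k} {n : ℕ} {x : ℕ → k}
    (hx : Function.Injective x)
    (h : ∀ i, ∃ z : AlgebraicClosure k,
      aeval ![algebraMap k _ (x i), 1, z] F = 0 ∧ Module.finrank k k⟮z⟯ ≤ n) :
    HasInfiniteLevelProg F x n := by
  choose z hz hn using h
  refine ⟨fun i => ![algebraMap k _ (x i), 1, z i], fun i j hij => ?_, fun i => ⟨?_, rfl, rfl, ?_⟩⟩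
  · exact hx ((algebraMap k _).injective (congrFun hij 0))
  · rw [eval_map, ← aeval_def, hz]
  · have : IntermediateField.adjoin k (Set.range ![algebraMap k _ (x i), 1, z i]) = k⟮z i⟯ := by
      refine le_antisymm (adjoin_le_iff.mpr ?_) (IntermediateField.adjoin.mono _ _ _ ?_)
      · rintro _ ⟨j, rfl⟩
        fin_cases j
        exacts [IntermediateField.algebraMap_mem _ _, one_mem _, mem_adjoin_simple_self k (z i)]
      · rintro _ rfl
        exact ⟨2, rfl⟩
    rw [this]
    exact hn i

/-- There are infinite geometric and arithmetic progressions avoiding a given element. -/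
lemma exists_isGeomProg_forall_ne [CharZero k] (x₀ : k) :
    ∃ x : ℕ → k, IsGeomProg x ∧ Function.Injective x ∧ ∀ i, x i ≠ x₀ := by
  obtain ⟨t', ht', hx₀⟩ : ∃ t' : k, t' ≠ 0 ∧ (x₀ = t' ∨ x₀ = 0) := by
    by_cases h : x₀ = 0
    · exact ⟨1, one_ne_zero, Or.inr h⟩
    · exact ⟨x₀, h, Or.inl rfl⟩
  have hinj : Function.Injective fun i : ℕ => t' * (2 : k) ^ i := fun i j hij => by
    have h1 : ((2 ^ i : ℕ) : k) = (2 ^ j : ℕ) := by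
      push_cast
      exact mul_left_cancel₀ ht' hij
    exact Nat.pow_right_injective le_rfl (Nat.cast_injective h1)
  refine ⟨fun i => t' * 2 ^ (i + 1), ⟨2, t', two_ne_zero, ht', fun _ => rfl⟩,
    fun i j hij => Nat.succ_injective (hinj hij), fun i => ?_⟩
  rcases hx₀ with rfl | rfl
  · intro h
    exact Nat.succ_ne_zero i (hinj (a₁ := i + 1) (a₂ := 0) (by simpa using h))
  · exact mul_ne_zero ht' (pow_ne_zero _ two_ne_zero)

lemma exists_isArithProg_forall_ne [CharZero k] (x₀ : k) :
    ∃ x : ℕ → k, IsArithProg x ∧ Function.Injective x ∧ ∀ i, x i ≠ x₀ := by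
  obtain ⟨t', ht', hx₀⟩ : ∃ t' : k, t' ≠ 0 ∧ ∀ i : ℕ, t' + (i + 1 : ℕ) * 1 ≠ x₀ := by
    by_cases h : x₀ = 0
    · refine ⟨1, one_ne_zero, fun i => ?_⟩
      rw [h, mul_one]
      exact_mod_cast (by omega : 1 + (i + 1) ≠ 0)
    · refine ⟨x₀, h, fun i => ?_⟩
      rw [mul_one, Ne, add_eq_left]
      exact Nat.cast_ne_zero.mpr i.succ_ne_zero
  refine ⟨fun i => t' + (i + 1 : ℕ) * 1, ⟨1, t', one_ne_zero, ht', fun _ => rfl⟩,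
    fun i j hij => ?_, hx₀⟩
  simpa using hij

end Progression

/-- **Infinite `n`-level progressions for `n ≥ gon(C,k)`.**
Let `C : F(X,Y,Z) = 0` be a smooth plane curve of degree `d ≥ 4` over a number field `k` with
`C(k) ≠ ∅`.  Then for every integer `n ≥ gon(C,k)`, the curve `C` admits (on a plane model
`F' = 0` obtained from `F` by a `k`-linear change of coordinates) an `n`-level progression
sequence of infinite length; this holds both with the `x`-coordinates forming an infinite
arithmetic progression and with the `x`-coordinates forming an infinite geometric
progression in `k`. -/
theorem infinite_n_level_progression_of_gonality_le
    (k : Type) [Field k] [NumberField k]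
    (d : ℕ) (hd : 4 ≤ d)
    (F : MvPolynomial (Fin 3) k) (hF : IsSmoothPlaneCurve d F)
    [IsDomain (PlaneCurveRing k F)]
    (hpt : ∃ p : Fin 3 → k, (∃ j, p j = 1) ∧ eval p F = 0)
    (n : ℕ) (hn : gonality k (FractionRing (PlaneCurveRing k F)) ≤ n) :
    ∃ F' : MvPolynomial (Fin 3) k, IsLinearChange F F' ∧
      (∃ x : ℕ → k, IsGeomProg x ∧ Function.Injective x ∧
        HasInfiniteLevelProg F' x n) ∧
      (∃ x : ℕ → k, IsArithProg x ∧ Function.Injective x ∧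
        HasInfiniteLevelProg F' x n) := by
  obtain ⟨q, ⟨j, hj⟩, hq⟩ := hpt
  obtain ⟨A, hA⟩ := exists_generalLinearGroup_col_eq hj
  have hF' : IsSmoothPlaneCurve d (linSubst A F) :=
    hF.linSubst ((Matrix.isUnit_iff_isUnit_det _).mp A.isUnit)
  have h0 : eval ![0, 0, 1] (linSubst (A : Matrix (Fin 3) (Fin 3) k) F) = 0 := by
    refine Eq.trans ?_ hq
    rw [eval_eq_aeval, aeval_linSubst, eval_eq_aeval]
    congr 2
    ext i
    simp [Fin.sum_univ_three, hA]
  have hgon := le_gonality_fractionRing_add_one (by omega) hF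
  obtain ⟨x₀, hx₀⟩ := exists_forall_ne_exists_aeval_eq_zero (by omega) hF' h0
  have key : ∀ x : ℕ → k, Function.Injective x → (∀ i, x i ≠ x₀) →
      HasInfiniteLevelProg (linSubst (A : Matrix (Fin 3) (Fin 3) k) F) x n := by
    refine fun x hinj hne => hasInfiniteLevelProg_of_forall_exists hinj fun i => ?_
    obtain ⟨z, hz, hdeg⟩ := hx₀ (x i) (hne i)
    exact ⟨z, hz, hdeg.trans (by omega)⟩
  obtain ⟨x, hx, hinj, hne⟩ := exists_isGeomProg_forall_ne x₀
  obtain ⟨x', hx', hinj', hne'⟩ := exists_isArithProg_forall_ne x₀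
  exact ⟨_, ⟨A, rfl⟩, ⟨x, hx, hinj, key x hinj hne⟩, ⟨x', hx', hinj', key x' hinj' hne'⟩⟩
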